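/- Let X, Y, Z, A, B, C be random variables whose joint distribution factorizes as P_{XYZABC} = P_A · P_B · P_C · P_{X|BC} · P_{Y|AC} · P_{Z|AB}. Then for every choice of four distinct variables (X1, X2, X3, X4) from {X, Y, Z, A, B, C}, EXCEPT the choices with unordered pairs ({X1,X2},{X3,X4}) equal to ({X,Y},{Z,C}), ({X,Z},{Y,B}) or ({Y,Z},{X,A}), the Ingleton quantity satisfies I_ING(X1,X2;X3,X4) ≥ 0 (so that any inequality consisting of the Ingleton quantity plus nonnegative multiples of (conditional) mutual informations is automatically satisfied for these choices). -/

import Mathlib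

open Finset
open scoped Classical

/-- Probability that the random variable `X` (on the finite weighted sample space
`(Ω, μ)`) takes the value `b`. -/
noncomputable def pr {Ω β : Type*} [Fintype Ω] (μ : Ω → ℝ) (X : Ω → β) (b : β) : ℝ :=
  ∑ ω, if X ω = b then μ ω else 0

/-- Shannon entropy of the random variable `X` on the finite weighted sample space
`(Ω, μ)`. -/
noncomputable def ent {Ω β : Type*} [Fintype Ω] [Fintype β] (μ : Ω → ℝ) (X : Ω → β) : ℝ :=
  ∑ b, Real.negMulLog (pr μ X b)

/-- Mutual information `I(X : Y)`. -/
noncomputable def mi {Ω β γ : Type*} [Fintype Ω] [Fintype β] [Fintype γ]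
    (μ : Ω → ℝ) (X : Ω → β) (Y : Ω → γ) : ℝ :=
  ent μ X + ent μ Y - ent μ (fun ω => (X ω, Y ω))

/-- Conditional mutual information `I(X : Y | Z)`. -/
noncomputable def cmi {Ω β γ δ : Type*} [Fintype Ω] [Fintype β] [Fintype γ] [Fintype δ]
    (μ : Ω → ℝ) (X : Ω → β) (Y : Ω → γ) (Z : Ω → δ) : ℝ :=
  ent μ (fun ω => (X ω, Z ω)) + ent μ (fun ω => (Y ω, Z ω)) - ent μ Z
    - ent μ (fun ω => (X ω, Y ω, Z ω))

/-- The Ingleton quantity `I_ING(S,T;U,V)`. -/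
noncomputable def ing {Ω β γ δ ε : Type*} [Fintype Ω] [Fintype β] [Fintype γ] [Fintype δ]
    [Fintype ε] (μ : Ω → ℝ) (S : Ω → β) (T : Ω → γ) (U : Ω → δ) (V : Ω → ε) : ℝ :=
  cmi μ S T U + cmi μ S T V + mi μ U V - mi μ S T

section FiniteEntropy

variable {Ω β γ δ ε : Type*} [Fintype Ω] {μ : Ω → ℝ}

lemma pr_nonneg (hμ0 : ∀ ω, 0 ≤ μ ω) (X : Ω → β) (b : β) : 0 ≤ pr μ X b :=
  sum_nonneg fun ω _ => by split_ifs <;> simp [hμ0]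

lemma sum_pr [Fintype β] (μ : Ω → ℝ) (X : Ω → β) : ∑ b, pr μ X b = ∑ ω, μ ω := by
  unfold pr
  rw [sum_comm]
  simp

lemma pr_comp [Fintype β] (μ : Ω → ℝ) (X : Ω → β) (f : β → γ) (c : γ) :
    pr μ (fun ω => f (X ω)) c = ∑ b, if f b = c then pr μ X b else 0 := by
  unfold pr
  simp_rw [← sum_filter (fun b => f b = c)]
  rw [sum_comm]
  simp

lemma sum_pr_pair_right [Fintype γ] (μ : Ω → ℝ) (X : Ω → β) (Y : Ω → γ) (b : β) :
    ∑ c, pr μ (fun ω => (X ω, Y ω)) (b, c) = pr μ X b := by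
  unfold pr
  rw [sum_comm]
  simp [Prod.mk.injEq, ite_and]

lemma sum_pr_pair_left [Fintype β] (μ : Ω → ℝ) (X : Ω → β) (Y : Ω → γ) (c : γ) :
    ∑ b, pr μ (fun ω => (X ω, Y ω)) (b, c) = pr μ Y c := by
  unfold pr
  rw [sum_comm]
  simp [Prod.mk.injEq, ite_and]

lemma sum_pr_triple_mid [Fintype γ] (μ : Ω → ℝ) (X : Ω → β) (Y : Ω → γ) (Z : Ω → δ)
    (b : β) (d : δ) :
    ∑ c, pr μ (fun ω => (X ω, Y ω, Z ω)) (b, c, d) = pr μ (fun ω => (X ω, Z ω)) (b, d) := by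
  unfold pr
  rw [sum_comm]
  simp [Prod.mk.injEq, ite_and]

lemma pr_comp_equiv (μ : Ω → ℝ) (X : Ω → β) (e : β ≃ γ) (b : β) :
    pr μ (fun ω => e (X ω)) (e b) = pr μ X b := by
  simp [pr]

lemma ent_comp_equiv [Fintype β] [Fintype γ] (μ : Ω → ℝ) (X : Ω → β) (e : β ≃ γ) :
    ent μ (fun ω => e (X ω)) = ent μ X := by
  unfold ent
  rw [← e.sum_comp]
  simp only [pr_comp_equiv]

lemma ent_pair_comm [Fintype β] [Fintype γ] (μ : Ω → ℝ) (X : Ω → β) (Y : Ω → γ) :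
    ent μ (fun ω => (X ω, Y ω)) = ent μ (fun ω => (Y ω, X ω)) :=
  ent_comp_equiv μ (fun ω => (Y ω, X ω)) (Equiv.prodComm γ β)

lemma ent_triple_swap_left [Fintype β] [Fintype γ] [Fintype δ] (μ : Ω → ℝ)
    (X : Ω → β) (Y : Ω → γ) (Z : Ω → δ) :
    ent μ (fun ω => (X ω, Y ω, Z ω)) = ent μ (fun ω => (Y ω, X ω, Z ω)) :=
  ent_comp_equiv μ (fun ω => (Y ω, X ω, Z ω))
    ⟨fun p => (p.2.1, p.1, p.2.2), fun p => (p.2.1, p.1, p.2.2), fun _ => rfl, fun _ => rfl⟩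

lemma ent_triple_swap_right [Fintype β] [Fintype γ] [Fintype δ] (μ : Ω → ℝ)
    (X : Ω → β) (Y : Ω → γ) (Z : Ω → δ) :
    ent μ (fun ω => (X ω, Y ω, Z ω)) = ent μ (fun ω => (X ω, Z ω, Y ω)) :=
  ent_comp_equiv μ (fun ω => (X ω, Z ω, Y ω)) ((Equiv.refl β).prodCongr (Equiv.prodComm δ γ))

lemma mi_comm [Fintype β] [Fintype γ] (μ : Ω → ℝ) (X : Ω → β) (Y : Ω → γ) :
    mi μ X Y = mi μ Y X := by
  unfold mi
  rw [ent_pair_comm μ X Y]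
  ring

lemma cmi_comm [Fintype β] [Fintype γ] [Fintype δ] (μ : Ω → ℝ)
    (X : Ω → β) (Y : Ω → γ) (Z : Ω → δ) : cmi μ X Y Z = cmi μ Y X Z := by
  unfold cmi
  rw [ent_triple_swap_left μ X Y Z]
  ring

/-- The chain rule `I(X : Y | Z) + I(X : Z) = I(X : Z | Y) + I(X : Y)`. -/
lemma cmi_add_mi [Fintype β] [Fintype γ] [Fintype δ] (μ : Ω → ℝ)
    (X : Ω → β) (Y : Ω → γ) (Z : Ω → δ) :
    cmi μ X Y Z + mi μ X Z = cmi μ X Z Y + mi μ X Y := by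
  unfold cmi mi
  rw [ent_triple_swap_right μ X Y Z, ent_pair_comm μ Y Z]
  ring

lemma sub_le_mul_log_sub {p a b c : ℝ} (hp : 0 ≤ p) (ha : p ≤ a) (hb : p ≤ b) (hc : p ≤ c) :
    p - a * b / c ≤ p * (Real.log p + Real.log c - Real.log a - Real.log b) := by
  rcases hp.eq_or_lt with rfl | hp
  · have : 0 ≤ a * b / c := by positivity
    simpa using this
  · have ha' := hp.trans_le ha
    have hb' := hp.trans_le hb
    have hc' := hp.trans_le hc
    have h := Real.log_le_sub_one_of_pos (show 0 < a * b / (c * p) by positivity)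
    rw [Real.log_div (by positivity) (by positivity), Real.log_mul ha'.ne' hb'.ne',
      Real.log_mul hc'.ne' hp.ne'] at h
    have h' := mul_le_mul_of_nonneg_left h hp.le
    have e : p * (a * b / (c * p) - 1) = a * b / c - p := by field_simp
    linarith

lemma cmi_nonneg [Fintype β] [Fintype γ] [Fintype δ] (hμ0 : ∀ ω, 0 ≤ μ ω)
    (X : Ω → β) (Y : Ω → γ) (Z : Ω → δ) : 0 ≤ cmi μ X Y Z := by
  set p : β → γ → δ → ℝ := fun x y z => pr μ (fun ω => (X ω, Y ω, Z ω)) (x, y, z) with hp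
  set a : β → δ → ℝ := fun x z => pr μ (fun ω => (X ω, Z ω)) (x, z) with ha
  set b : γ → δ → ℝ := fun y z => pr μ (fun ω => (Y ω, Z ω)) (y, z) with hb
  set c : δ → ℝ := pr μ Z with hc
  have p0 x y z : 0 ≤ p x y z := pr_nonneg hμ0 _ _
  have b0 y z : 0 ≤ b y z := pr_nonneg hμ0 _ _
  have pa x z : ∑ y, p x y z = a x z := sum_pr_triple_mid μ X Y Z x z
  have pb y z : ∑ x, p x y z = b y z := sum_pr_pair_left μ X (fun ω => (Y ω, Z ω)) (y, z)
  have ac z : ∑ x, a x z = c z := sum_pr_pair_left μ X Z z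
  have bc z : ∑ y, b y z = c z := sum_pr_pair_left μ Y Z z
  have ple_a x y z : p x y z ≤ a x z :=
    pa x z ▸ single_le_sum (f := fun y => p x y z) (fun y _ => p0 x y z) (mem_univ y)
  have ple_b x y z : p x y z ≤ b y z :=
    pb y z ▸ single_le_sum (f := fun x => p x y z) (fun x _ => p0 x y z) (mem_univ x)
  have ple_c x y z : p x y z ≤ c z :=
    (ple_b x y z).trans
      (bc z ▸ single_le_sum (f := fun y => b y z) (fun y _ => b0 y z) (mem_univ y))
  have total : ∑ z, ∑ y, ∑ x, a x z * b y z / c z = ∑ z, ∑ y, ∑ x, p x y z := by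
    refine sum_congr rfl fun z _ => ?_
    simp_rw [pb, ← sum_div, ← sum_mul, ac, ← mul_sum, bc]
    exact mul_self_div_self _
  have entp : ent μ (fun ω => (X ω, Y ω, Z ω))
      = -∑ z, ∑ y, ∑ x, p x y z * Real.log (p x y z) := by
    unfold ent
    simp_rw [Fintype.sum_prod_type_right, Real.negMulLog, neg_mul, sum_neg_distrib, hp]
  have enta : ent μ (fun ω => (X ω, Z ω))
      = -∑ z, ∑ y, ∑ x, p x y z * Real.log (a x z) := by
    unfold ent
    simp_rw [Fintype.sum_prod_type_right, Real.negMulLog, neg_mul, sum_neg_distrib]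
    congr 1
    refine sum_congr rfl fun z _ => ?_
    rw [sum_comm]
    simp_rw [← sum_mul, pa, ha]
  have entb : ent μ (fun ω => (Y ω, Z ω))
      = -∑ z, ∑ y, ∑ x, p x y z * Real.log (b y z) := by
    unfold ent
    simp_rw [Fintype.sum_prod_type_right, Real.negMulLog, neg_mul, sum_neg_distrib,
      ← sum_mul, pb, hb]
  have entc : ent μ Z = -∑ z, ∑ y, ∑ x, p x y z * Real.log (c z) := by
    unfold ent
    simp_rw [Real.negMulLog, neg_mul, sum_neg_distrib, ← sum_mul, pb, bc, hc]
  have key : ∑ z, ∑ y, ∑ x, (p x y z - a x z * b y z / c z) ≤ ∑ z, ∑ y, ∑ x, p x y z *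
      (Real.log (p x y z) + Real.log (c z) - Real.log (a x z) - Real.log (b y z)) := by
    gcongr
    exact sub_le_mul_log_sub (p0 _ _ _) (ple_a _ _ _) (ple_b _ _ _) (ple_c _ _ _)
  simp_rw [mul_sub, mul_add, sum_sub_distrib, sum_add_distrib] at key
  unfold cmi
  rw [entp, enta, entb, entc]
  linarith

lemma mi_nonneg [Fintype β] [Fintype γ] (hμ0 : ∀ ω, 0 ≤ μ ω) (hμ1 : ∑ ω, μ ω = 1)
    (X : Ω → β) (Y : Ω → γ) : 0 ≤ mi μ X Y := by
  have h := cmi_nonneg hμ0 X Y (fun _ => ())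
  have h1 : ent μ (fun ω => (X ω, ())) = ent μ X :=
    ent_comp_equiv μ X (Equiv.prodPUnit β).symm
  have h2 : ent μ (fun ω => (Y ω, ())) = ent μ Y :=
    ent_comp_equiv μ Y (Equiv.prodPUnit γ).symm
  have h3 : ent μ (fun ω => (X ω, Y ω, ())) = ent μ (fun ω => (X ω, Y ω)) :=
    ent_comp_equiv μ (fun ω => (X ω, Y ω))
      ((Equiv.refl β).prodCongr (Equiv.prodPUnit γ).symm)
  have h4 : ent μ (fun _ => ()) = 0 := by simp [ent, pr, hμ1]
  unfold cmi at h
  unfold mi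
  linarith

/-- Independence of two random variables on a finite weighted sample space. -/
def PrIndep (μ : Ω → ℝ) (X : Ω → β) (Y : Ω → γ) : Prop :=
  ∀ b c, pr μ (fun ω => (X ω, Y ω)) (b, c) = pr μ X b * pr μ Y c

lemma PrIndep.of_factor [Fintype β] [Fintype γ] {X : Ω → β} {Y : Ω → γ} {f : β → ℝ} {g : γ → ℝ}
    (hf : ∑ b, f b = 1) (hg : ∑ c, g c = 1)
    (h : ∀ b c, pr μ (fun ω => (X ω, Y ω)) (b, c) = f b * g c) : PrIndep μ X Y := by
  intro b c
  rw [← sum_pr_pair_right μ X Y b, ← sum_pr_pair_left μ X Y c]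
  simp_rw [h, ← mul_sum, ← sum_mul, hf, hg, mul_one, one_mul]

lemma PrIndep.comp [Fintype β] [Fintype γ] {X : Ω → β} {Y : Ω → γ} (h : PrIndep μ X Y)
    (f : β → δ) (g : γ → ε) : PrIndep μ (fun ω => f (X ω)) (fun ω => g (Y ω)) := by
  intro d e
  rw [pr_comp μ X f, pr_comp μ Y g,
    pr_comp μ (fun ω => (X ω, Y ω)) (fun q => (f q.1, g q.2)), Fintype.sum_prod_type, sum_mul_sum]
  refine sum_congr rfl fun b _ => sum_congr rfl fun c _ => ?_
  by_cases hb : f b = d <;> by_cases hc : g c = e <;> simp [hb, hc, h b c]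

lemma PrIndep.mi_eq_zero [Fintype β] [Fintype γ] (hμ1 : ∑ ω, μ ω = 1) {X : Ω → β} {Y : Ω → γ}
    (h : PrIndep μ X Y) : mi μ X Y = 0 := by
  have hX := (sum_pr μ X).trans hμ1
  have hY := (sum_pr μ Y).trans hμ1
  have hXY : ent μ (fun ω => (X ω, Y ω)) = ent μ X + ent μ Y := by
    unfold ent
    simp_rw [Fintype.sum_prod_type, h _ _, Real.negMulLog_mul, sum_add_distrib, ← mul_sum,
      ← sum_mul, hX, hY, one_mul]
  rw [mi, hXY, sub_self]

lemma mi_le_cmi_of_mi_left_eq_zero [Fintype β] [Fintype γ] [Fintype δ] (hμ0 : ∀ ω, 0 ≤ μ ω)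
    {X : Ω → β} {Y : Ω → γ} {Z : Ω → δ} (h : mi μ X Z = 0) : mi μ X Y ≤ cmi μ X Y Z := by
  linarith [cmi_add_mi μ X Y Z, cmi_nonneg hμ0 X Z Y]

lemma mi_le_cmi_of_mi_right_eq_zero [Fintype β] [Fintype γ] [Fintype δ] (hμ0 : ∀ ω, 0 ≤ μ ω)
    {X : Ω → β} {Y : Ω → γ} {Z : Ω → δ} (h : mi μ Y Z = 0) : mi μ X Y ≤ cmi μ X Y Z := by
  rw [mi_comm, cmi_comm]
  exact mi_le_cmi_of_mi_left_eq_zero hμ0 h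

/-- The Ingleton inequality holds if `S` and `T` are independent, or if one of `S`, `T` is
independent of one of `U`, `V`. -/
lemma ing_nonneg_of_mi_eq_zero [Fintype β] [Fintype γ] [Fintype δ] [Fintype ε]
    (hμ0 : ∀ ω, 0 ≤ μ ω) (hμ1 : ∑ ω, μ ω = 1)
    {S : Ω → β} {T : Ω → γ} {U : Ω → δ} {V : Ω → ε}
    (h : mi μ S T = 0 ∨ mi μ S U = 0 ∨ mi μ T U = 0 ∨ mi μ S V = 0 ∨ mi μ T V = 0) :
    0 ≤ ing μ S T U V := by
  have hU := cmi_nonneg hμ0 S T U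
  have hV := cmi_nonneg hμ0 S T V
  have hUV := mi_nonneg hμ0 hμ1 U V
  unfold ing
  rcases h with h | h | h | h | h
  · linarith
  · linarith [mi_le_cmi_of_mi_left_eq_zero (Y := T) hμ0 h]
  · linarith [mi_le_cmi_of_mi_right_eq_zero (X := S) hμ0 h]
  · linarith [mi_le_cmi_of_mi_left_eq_zero (Y := T) hμ0 h]
  · linarith [mi_le_cmi_of_mi_right_eq_zero (X := S) hμ0 h]

end FiniteEntropy

set_option synthInstance.maxSize 4000 in
/-- In every non-exceptional choice of four indices, one of the pairs `{i, j}`, `{i, k}`, `{j, k}`,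
`{i, l}`, `{j, l}` consists of two hidden variables or of an observed variable and the hidden
variable it does not depend on. -/
lemma exists_unlinked_pair : ∀ i j k l : Fin 6,
    ¬ ((({i, j} : Finset (Fin 6)) = {0, 1} ∧ ({k, l} : Finset (Fin 6)) = {2, 5}) ∨
       (({i, j} : Finset (Fin 6)) = {0, 2} ∧ ({k, l} : Finset (Fin 6)) = {1, 4}) ∨
       (({i, j} : Finset (Fin 6)) = {1, 2} ∧ ({k, l} : Finset (Fin 6)) = {0, 3})) →
    i ≠ j → i ≠ k → i ≠ l → j ≠ k → j ≠ l → k ≠ l →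
    ((3 ≤ i ∧ 3 ≤ j) ∨ j = i + 3) ∨ ((3 ≤ i ∧ 3 ≤ k) ∨ k = i + 3) ∨
    ((3 ≤ j ∧ 3 ≤ k) ∨ k = j + 3) ∨ ((3 ≤ i ∧ 3 ≤ l) ∨ l = i + 3) ∨
    ((3 ≤ j ∧ 3 ≤ l) ∨ l = j + 3) := by
  decide +kernel

/-- **Redundant Ingleton instances in the classical triangle causal structure.**
Index the six variables of the triangle causal structure by `Fin 6` via
`0 ↦ X, 1 ↦ Y, 2 ↦ Z, 3 ↦ A, 4 ↦ B, 5 ↦ C`.  For any joint distribution compatible with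
the triangle causal structure (`P_{XYZABC} = P_A P_B P_C P_{X|BC} P_{Y|AC} P_{Z|AB}`),
every choice of four distinct variables `(X1,X2,X3,X4)` satisfies
`I_ING(X1,X2;X3,X4) ≥ 0`, except possibly when the unordered pairs
`({X1,X2},{X3,X4})` equal `({X,Y},{Z,C})`, `({X,Z},{Y,B})` or `({Y,Z},{X,A})`. -/
theorem triangle_ingleton_nonneg_except
    {Ω SX SY SZ SA SB SC : Type*} [Fintype Ω] [Fintype SX] [Fintype SY] [Fintype SZ]
    [Fintype SA] [Fintype SB] [Fintype SC]
    (μ : Ω → ℝ) (hμ0 : ∀ ω, 0 ≤ μ ω) (hμ1 : ∑ ω, μ ω = 1)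
    (X : Ω → SX) (Y : Ω → SY) (Z : Ω → SZ) (A : Ω → SA) (B : Ω → SB) (C : Ω → SC)
    (pA : SA → ℝ) (pB : SB → ℝ) (pC : SC → ℝ)
    (qX : SX → SB → SC → ℝ) (qY : SY → SA → SC → ℝ) (qZ : SZ → SA → SB → ℝ)
    (hpA0 : ∀ a, 0 ≤ pA a) (hpA1 : ∑ a, pA a = 1)
    (hpB0 : ∀ b, 0 ≤ pB b) (hpB1 : ∑ b, pB b = 1)
    (hpC0 : ∀ c, 0 ≤ pC c) (hpC1 : ∑ c, pC c = 1)
    (hqX0 : ∀ x b c, 0 ≤ qX x b c) (hqX1 : ∀ b c, ∑ x, qX x b c = 1)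
    (hqY0 : ∀ y a c, 0 ≤ qY y a c) (hqY1 : ∀ a c, ∑ y, qY y a c = 1)
    (hqZ0 : ∀ z a b, 0 ≤ qZ z a b) (hqZ1 : ∀ a b, ∑ z, qZ z a b = 1)
    (hfact : ∀ x y z a b c,
      pr μ (fun ω => (X ω, Y ω, Z ω, A ω, B ω, C ω)) (x, y, z, a, b, c)
        = pA a * pB b * pC c * qX x b c * qY y a c * qZ z a b) :
    let V : Fin 6 → Ω → SX ⊕ SY ⊕ SZ ⊕ SA ⊕ SB ⊕ SC :=
      ![fun ω => Sum.inl (X ω),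
        fun ω => Sum.inr (Sum.inl (Y ω)),
        fun ω => Sum.inr (Sum.inr (Sum.inl (Z ω))),
        fun ω => Sum.inr (Sum.inr (Sum.inr (Sum.inl (A ω)))),
        fun ω => Sum.inr (Sum.inr (Sum.inr (Sum.inr (Sum.inl (B ω))))),
        fun ω => Sum.inr (Sum.inr (Sum.inr (Sum.inr (Sum.inr (C ω)))))]
    ∀ i j k l : Fin 6, i ≠ j → i ≠ k → i ≠ l → j ≠ k → j ≠ l → k ≠ l →
      ¬ ((({i, j} : Finset (Fin 6)) = {0, 1} ∧ ({k, l} : Finset (Fin 6)) = {2, 5}) ∨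
         (({i, j} : Finset (Fin 6)) = {0, 2} ∧ ({k, l} : Finset (Fin 6)) = {1, 4}) ∨
         (({i, j} : Finset (Fin 6)) = {1, 2} ∧ ({k, l} : Finset (Fin 6)) = {0, 3})) →
      0 ≤ ing μ (V i) (V j) (V k) (V l) := by
  intro V i j k l hij hik hil hjk hjl hkl hne
  have indA : PrIndep μ A (fun ω => (X ω, B ω, C ω)) := by
    refine .of_factor (f := pA) (g := fun q => pB q.2.1 * pC q.2.2 * qX q.1 q.2.1 q.2.2) hpA1
      ?_ ?_
    · rw [Fintype.sum_prod_type_right]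
      simp_rw [← mul_sum, hqX1, Fintype.sum_prod_type, mul_one, ← mul_sum, hpC1, mul_one, hpB1]
    · rintro a ⟨x, b, c⟩
      have h : pr μ (fun ω => (A ω, X ω, B ω, C ω)) (a, x, b, c) = ∑ y, ∑ z,
          pr μ (fun ω => (X ω, Y ω, Z ω, A ω, B ω, C ω)) (x, y, z, a, b, c) := by
        rw [pr_comp μ (fun ω => (X ω, Y ω, Z ω, A ω, B ω, C ω))
          (fun q => (q.2.2.2.1, q.1, q.2.2.2.2.1, q.2.2.2.2.2))]
        simp [Fintype.sum_prod_type, Prod.mk.injEq, ite_and]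
      simp_rw [h, hfact, ← mul_sum, hqZ1, mul_one, ← mul_sum, hqY1]
      ring
  have indB : PrIndep μ B (fun ω => (Y ω, A ω, C ω)) := by
    refine .of_factor (f := pB) (g := fun q => pA q.2.1 * pC q.2.2 * qY q.1 q.2.1 q.2.2) hpB1
      ?_ ?_
    · rw [Fintype.sum_prod_type_right]
      simp_rw [← mul_sum, hqY1, Fintype.sum_prod_type, mul_one, ← mul_sum, hpC1, mul_one, hpA1]
    · rintro b ⟨y, a, c⟩
      have h : pr μ (fun ω => (B ω, Y ω, A ω, C ω)) (b, y, a, c) = ∑ x, ∑ z,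
          pr μ (fun ω => (X ω, Y ω, Z ω, A ω, B ω, C ω)) (x, y, z, a, b, c) := by
        rw [pr_comp μ (fun ω => (X ω, Y ω, Z ω, A ω, B ω, C ω))
          (fun q => (q.2.2.2.2.1, q.2.1, q.2.2.2.1, q.2.2.2.2.2))]
        simp [Fintype.sum_prod_type, Prod.mk.injEq, ite_and]
      simp_rw [h, hfact, ← mul_sum, hqZ1, mul_one, ← sum_mul, ← mul_sum, hqX1]
      ring
  have indC : PrIndep μ C (fun ω => (Z ω, A ω, B ω)) := by
    refine .of_factor (f := pC) (g := fun q => pA q.2.1 * pB q.2.2 * qZ q.1 q.2.1 q.2.2) hpC1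
      ?_ ?_
    · rw [Fintype.sum_prod_type_right]
      simp_rw [← mul_sum, hqZ1, Fintype.sum_prod_type, mul_one, ← mul_sum, hpB1, mul_one, hpA1]
    · rintro c ⟨z, a, b⟩
      have h : pr μ (fun ω => (C ω, Z ω, A ω, B ω)) (c, z, a, b) = ∑ x, ∑ y,
          pr μ (fun ω => (X ω, Y ω, Z ω, A ω, B ω, C ω)) (x, y, z, a, b, c) := by
        rw [pr_comp μ (fun ω => (X ω, Y ω, Z ω, A ω, B ω, C ω))
          (fun q => (q.2.2.2.2.2, q.2.2.1, q.2.2.2.1, q.2.2.2.2.1))]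
        simp [Fintype.sum_prod_type, Prod.mk.injEq, ite_and]
      simp_rw [h, hfact, ← sum_mul, ← mul_sum, hqY1, mul_one, ← mul_sum, hqX1]
      ring
  have unlinked : ∀ m n : Fin 6, m ≠ n → ((3 ≤ m ∧ 3 ≤ n) ∨ n = m + 3) →
      mi μ (V m) (V n) = 0 := by
    let ιA : SA → SX ⊕ SY ⊕ SZ ⊕ SA ⊕ SB ⊕ SC := fun q => .inr (.inr (.inr (.inl q)))
    let ιB : SB → SX ⊕ SY ⊕ SZ ⊕ SA ⊕ SB ⊕ SC := fun q => .inr (.inr (.inr (.inr (.inl q))))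
    let ιC : SC → SX ⊕ SY ⊕ SZ ⊕ SA ⊕ SB ⊕ SC := fun q => .inr (.inr (.inr (.inr (.inr q))))
    have hXA : PrIndep μ (V 3) (V 0) :=
      indA.comp ιA (fun q => Sum.inl q.1)
    have hYB : PrIndep μ (V 4) (V 1) :=
      indB.comp ιB (fun q => Sum.inr (Sum.inl q.1))
    have hZC : PrIndep μ (V 5) (V 2) :=
      indC.comp ιC (fun q => Sum.inr (Sum.inr (Sum.inl q.1)))
    have hAB : PrIndep μ (V 3) (V 4) :=
      indA.comp ιA (fun q => ιB q.2.1)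
    have hAC : PrIndep μ (V 3) (V 5) :=
      indA.comp ιA (fun q => ιC q.2.2)
    have hBC : PrIndep μ (V 4) (V 5) :=
      indB.comp ιB (fun q => ιC q.2.2)
    intro m n hmn h
    clear_value V
    fin_cases m <;> fin_cases n <;> first
      | exact absurd rfl hmn
      | exact absurd h (by decide)
      | exact PrIndep.mi_eq_zero hμ1 (by assumption)
      | exact (mi_comm _ _ _).trans (PrIndep.mi_eq_zero hμ1 (by assumption))
  refine ing_nonneg_of_mi_eq_zero hμ0 hμ1 ?_
  exact (exists_unlinked_pair i j k l hne hij hik hil hjk hjl hkl).imp (unlinked _ _ hij)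
    (.imp (unlinked _ _ hik) (.imp (unlinked _ _ hjk) (.imp (unlinked _ _ hil) (unlinked _ _ hjl))))
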